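/- For every τ > 0 and every y ∈ ℂ, the convolution of the channel density p_H with the complex Gaussian noise density φ_{τ²} satisfies ∫_ℂ p_H(y − w)·φ_{τ²}(w) dw = ∫₀^∞ (a·g^{−γ}·Q(g)/(π·(g²+τ²)))·exp(−|y|²/(g²+τ²)) dg. -/

import Mathlib

open MeasureTheory Set
open scoped ENNReal

noncomputable section

/-- `Q(g) = ∫_{b ln g + c}^∞ exp(-s²) ds`. -/
def Qfun (b c g : ℝ) : ℝ := ∫ s in Set.Ioi (b * Real.log g + c), Real.exp (-s ^ 2)

/-- Circularly symmetric complex Gaussian density of variance `v` on `ℂ ≅ ℝ²`. -/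
def cgauss (v : ℝ) (x : ℂ) : ℝ := (Real.pi * v)⁻¹ * Real.exp (-‖x‖ ^ 2 / v)

/-- Channel density `p_H(h) = (a/π)∫₀^∞ g^{-γ-2} Q(g) exp(-|h|²/g²) dg`. -/
def pH (a γ b c : ℝ) (h : ℂ) : ℝ :=
  (a / Real.pi) * ∫ g in Set.Ioi (0 : ℝ), g ^ (-γ - 2) * Qfun b c g * Real.exp (-‖h‖ ^ 2 / g ^ 2)

/-- `ν_i(s) = ∫₀^∞ g^{2-γ} Q(g) (g²+τ²)^{-(i+1)} exp(-s/(g²+τ²)) dg`. -/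
def nufun (γ b c τ : ℝ) (i : ℕ) (s : ℝ) : ℝ :=
  ∫ g in Set.Ioi (0 : ℝ),
    g ^ (2 - γ) * Qfun b c g / (g ^ 2 + τ ^ 2) ^ (i + 1) * Real.exp (-s / (g ^ 2 + τ ^ 2))

/-- `ξ_i(s) = ((1-λ)/(λ a τ^{2i})) exp(-s/τ²) + ∫₀^∞ g^{-γ} Q(g) (g²+τ²)^{-i} exp(-s/(g²+τ²)) dg`. -/
def xifun (a γ b c τ lam : ℝ) (i : ℕ) (s : ℝ) : ℝ :=
  (1 - lam) / (lam * a * τ ^ (2 * i)) * Real.exp (-s / τ ^ 2) +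
    ∫ g in Set.Ioi (0 : ℝ),
      g ^ (-γ) * Qfun b c g / (g ^ 2 + τ ^ 2) ^ i * Real.exp (-s / (g ^ 2 + τ ^ 2))

theorem integrable_exp_mul_sub_sq (k : ℝ) : Integrable fun s : ℝ => Real.exp (k * s - s ^ 2) := by
  have h := ((integrable_exp_neg_mul_sq one_pos).comp_sub_right (k / 2)).const_mul
    (Real.exp (k ^ 2 / 4))
  refine h.congr (.of_forall fun s => ?_)
  simp only
  rw [← Real.exp_add]
  congr 1
  ring

theorem integrable_exp_neg_sq : Integrable fun s : ℝ => Real.exp (-s ^ 2) := by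
  simpa using integrable_exp_neg_mul_sq one_pos

theorem Qfun_nonneg (b c g : ℝ) : 0 ≤ Qfun b c g :=
  integral_nonneg fun _ => (Real.exp_pos _).le

theorem measurable_Qfun (b c : ℝ) : Measurable (Qfun b c) := by
  have h : Antitone fun u : ℝ => ∫ s in Ioi u, Real.exp (-s ^ 2) := fun u v huv =>
    setIntegral_mono_set integrable_exp_neg_sq.integrableOn
      (.of_forall fun _ => (Real.exp_pos _).le) (Ioi_subset_Ioi huv).eventuallyLE
  exact h.measurable.comp ((Real.measurable_log.const_mul b).add_const c)

/-- The Gaussian tail decays faster than any exponential, so `Q` vanishes at `0` to any order. -/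
theorem exists_rpow_mul_Qfun_le {b : ℝ} (c : ℝ) {γ : ℝ} (hb : b < 0) (hγ : 0 ≤ γ) :
    ∃ C, ∀ g, 0 < g → g ^ (-γ) * Qfun b c g ≤ C := by
  set k := γ / -b with hk
  have hk0 : 0 ≤ k := div_nonneg hγ (neg_pos.2 hb).le
  have hkb : k * b = -γ := by
    rw [hk, div_neg, neg_mul, div_mul_cancel₀ _ hb.ne]
  refine ⟨Real.exp (-(k * c)) * ∫ s : ℝ, Real.exp (k * s - s ^ 2), fun g hg => ?_⟩
  set u := b * Real.log g + c with hu
  have h₁ : Qfun b c g ≤ Real.exp (-(k * u)) * ∫ s : ℝ, Real.exp (k * s - s ^ 2) := by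
    calc Qfun b c g
        ≤ ∫ s in Ioi u, Real.exp (-(k * u)) * Real.exp (k * s - s ^ 2) := by
          refine setIntegral_mono_on integrable_exp_neg_sq.integrableOn
            ((integrable_exp_mul_sub_sq k).const_mul _).integrableOn measurableSet_Ioi
            fun s hs => ?_
          rw [← Real.exp_add]
          have := mul_le_mul_of_nonneg_left (mem_Ioi.1 hs).le hk0
          gcongr
          linarith
      _ = Real.exp (-(k * u)) * ∫ s in Ioi u, Real.exp (k * s - s ^ 2) :=
          integral_const_mul _ _
      _ ≤ _ := by
          refine mul_le_mul_of_nonneg_left ?_ (Real.exp_pos _).le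
          exact setIntegral_le_integral (integrable_exp_mul_sub_sq k)
            (.of_forall fun _ => (Real.exp_pos _).le)
  calc g ^ (-γ) * Qfun b c g
      ≤ g ^ (-γ) * (Real.exp (-(k * u)) * ∫ s : ℝ, Real.exp (k * s - s ^ 2)) := by gcongr
    _ = _ := by
        rw [Real.rpow_def_of_pos hg, ← mul_assoc, ← Real.exp_add]
        congr 2
        rw [hu]
        linear_combination -Real.log g * hkb

theorem integral_exp_neg_mul_norm_sq {p : ℝ} (hp : 0 < p) :
    ∫ w : ℂ, Real.exp (-p * ‖w‖ ^ 2) = Real.pi / p := by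
  rw [GaussianFourier.integral_rexp_neg_mul_sq_norm hp, Complex.finrank_real_complex]
  norm_num

theorem gauss_mul_gauss_eq {p q : ℝ} (hp : 0 < p) (hq : 0 < q) (y w : ℂ) :
    Real.exp (-p * ‖y - w‖ ^ 2) * Real.exp (-q * ‖w‖ ^ 2) =
      Real.exp (-(p * q / (p + q)) * ‖y‖ ^ 2) *
        Real.exp (-(p + q) * ‖w - ((p / (p + q) : ℝ) : ℂ) * y‖ ^ 2) := by
  rw [← Real.exp_add, ← Real.exp_add]
  congr 1
  simp only [← Complex.normSq_eq_norm_sq, Complex.normSq_apply, Complex.sub_re, Complex.sub_im,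
    Complex.re_ofReal_mul, Complex.im_ofReal_mul]
  field_simp
  ring

theorem integral_gauss_mul_gauss {p q : ℝ} (hp : 0 < p) (hq : 0 < q) (y : ℂ) :
    ∫ w : ℂ, Real.exp (-p * ‖y - w‖ ^ 2) * Real.exp (-q * ‖w‖ ^ 2) =
      Real.exp (-(p * q / (p + q)) * ‖y‖ ^ 2) * (Real.pi / (p + q)) := by
  simp_rw [gauss_mul_gauss_eq hp hq, integral_const_mul]
  rw [integral_sub_right_eq_self (fun w : ℂ => Real.exp (-(p + q) * ‖w‖ ^ 2)),
    integral_exp_neg_mul_norm_sq (add_pos hp hq)]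

theorem integral_exp_mul_cgauss {g v : ℝ} (hg : 0 < g) (hv : 0 < v) (y : ℂ) :
    ∫ w : ℂ, Real.exp (-‖y - w‖ ^ 2 / g ^ 2) * cgauss v w =
      g ^ 2 / (g ^ 2 + v) * Real.exp (-‖y‖ ^ 2 / (g ^ 2 + v)) := by
  have h := integral_gauss_mul_gauss (inv_pos.2 (pow_pos hg 2)) (inv_pos.2 hv) y
  calc _ = ∫ w : ℂ, (Real.pi * v)⁻¹ *
        (Real.exp (-(g ^ 2)⁻¹ * ‖y - w‖ ^ 2) * Real.exp (-v⁻¹ * ‖w‖ ^ 2)) := by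
        refine integral_congr_ae (.of_forall fun w => ?_)
        simp only [cgauss, div_eq_inv_mul, mul_neg, neg_mul]
        ring
    _ = _ := by
        rw [integral_const_mul, h]
        have e : -((g ^ 2)⁻¹ * v⁻¹ / ((g ^ 2)⁻¹ + v⁻¹)) * ‖y‖ ^ 2 = -‖y‖ ^ 2 / (g ^ 2 + v) := by
          field_simp
          ring
        rw [e]
        field_simp
        ring

theorem integrable_exp_mul_cgauss {g v : ℝ} (hg : 0 < g) (hv : 0 < v) (y : ℂ) :
    Integrable fun w : ℂ => Real.exp (-‖y - w‖ ^ 2 / g ^ 2) * cgauss v w := by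
  refine not_imp_comm.1 integral_undef ?_
  rw [integral_exp_mul_cgauss hg hv]
  positivity

theorem integrable_inv_sq_add_sq {τ : ℝ} (hτ : 0 < τ) :
    Integrable fun g : ℝ => (g ^ 2 + τ ^ 2)⁻¹ := by
  have h := (integrable_inv_one_add_sq.comp_div hτ.ne').const_mul (τ ^ 2)⁻¹
  refine h.congr (.of_forall fun g => ?_)
  simp only
  field_simp
  ring

theorem cgauss_nonneg {v : ℝ} (hv : 0 ≤ v) (w : ℂ) : 0 ≤ cgauss v w := by
  unfold cgauss
  positivity

theorem integral_mixture_mul_cgauss (b c γ : ℝ) {g τ : ℝ} (hg : 0 < g) (hτ : 0 < τ) (y : ℂ) :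
    ∫ w : ℂ, g ^ (-γ - 2) * Qfun b c g * Real.exp (-‖y - w‖ ^ 2 / g ^ 2) * cgauss (τ ^ 2) w =
      g ^ (-γ) * Qfun b c g * (g ^ 2 + τ ^ 2)⁻¹ * Real.exp (-‖y‖ ^ 2 / (g ^ 2 + τ ^ 2)) := by
  simp_rw [mul_assoc _ (Real.exp _) (cgauss _ _)]
  rw [integral_const_mul, integral_exp_mul_cgauss hg (pow_pos hτ 2), Real.rpow_sub hg,
    Real.rpow_two]
  field_simp

theorem integrable_mixture {b : ℝ} (c : ℝ) {γ τ : ℝ} (hb : b < 0) (hγ : 0 ≤ γ)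
    (hτ : 0 < τ) (y : ℂ) :
    IntegrableOn (fun g : ℝ => g ^ (-γ) * Qfun b c g * (g ^ 2 + τ ^ 2)⁻¹ *
      Real.exp (-‖y‖ ^ 2 / (g ^ 2 + τ ^ 2))) (Ioi 0) := by
  obtain ⟨C, hC⟩ := exists_rpow_mul_Qfun_le c hb hγ
  refine ((integrable_inv_sq_add_sq hτ).const_mul C).integrableOn.mono' ?_ ?_
  · have := measurable_Qfun b c
    exact Measurable.aestronglyMeasurable (by fun_prop)
  · refine (ae_restrict_iff' measurableSet_Ioi).2 (.of_forall fun g (hg : 0 < g) => ?_)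
    have hQ := Qfun_nonneg b c g
    rw [Real.norm_of_nonneg (by positivity)]
    refine (mul_le_of_le_one_right (by positivity) ?_).trans ?_
    · rw [Real.exp_le_one_iff, neg_div]
      exact neg_nonpos.2 (by positivity)
    · gcongr
      exact hC g hg

theorem integrable_prod_mixture_mul_cgauss {b : ℝ} (c : ℝ) {γ τ : ℝ} (hb : b < 0) (hγ : 0 ≤ γ)
    (hτ : 0 < τ) (y : ℂ) :
    Integrable (Function.uncurry fun (w : ℂ) (g : ℝ) =>
      g ^ (-γ - 2) * Qfun b c g * Real.exp (-‖y - w‖ ^ 2 / g ^ 2) * cgauss (τ ^ 2) w)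
      (volume.prod (volume.restrict (Ioi 0))) := by
  have hm := measurable_Qfun b c
  rw [integrable_prod_iff']
  · constructor
    · refine (ae_restrict_iff' measurableSet_Ioi).2 (.of_forall fun g (hg : 0 < g) => ?_)
      simpa only [Function.uncurry, mul_assoc] using
        (integrable_exp_mul_cgauss hg (pow_pos hτ 2) y).const_mul (g ^ (-γ - 2) * Qfun b c g)
    · refine (integrable_mixture c hb hγ hτ y).congr ?_
      refine (ae_restrict_iff' measurableSet_Ioi).2 (.of_forall fun g (hg : 0 < g) => ?_)
      simp only
      rw [← integral_mixture_mul_cgauss b c γ hg hτ]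
      refine integral_congr_ae (.of_forall fun w => ?_)
      have hQ := Qfun_nonneg b c g
      have hG := cgauss_nonneg (pow_pos hτ 2).le w
      exact (Real.norm_of_nonneg (by positivity)).symm
  · refine Measurable.aestronglyMeasurable ?_
    unfold Function.uncurry cgauss
    fun_prop

/-- `∫_ℂ p_H(y-w) φ_{τ²}(w) dw = ∫₀^∞ (a g^{-γ} Q(g)/(π(g²+τ²))) exp(-|y|²/(g²+τ²)) dg`. -/
theorem stmt3
    (R α β σ : ℝ) (hR : 0 < R) (hβ : 0 < β) (hσ : 0 < σ)
    (γ a b c : ℝ)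
    (hγ : γ = 40 / β + 1)
    (ha : a = 40 / (R ^ 2 * β * Real.sqrt Real.pi) *
      Real.exp (2 * (Real.log 10) ^ 2 * σ ^ 2 / β ^ 2 - 2 * (Real.log 10) * α / β))
    (hb : b = -10 * Real.sqrt 2 / ((Real.log 10) * σ))
    (hc : c = (-α - β * Real.logb 10 R) / (Real.sqrt 2 * σ) - 20 / (β * b))
    (τ : ℝ) (hτ : 0 < τ) (y : ℂ) :
    ∫ w : ℂ, pH a γ b c (y - w) * cgauss (τ ^ 2) w =
      ∫ g in Set.Ioi (0 : ℝ),
        a * g ^ (-γ) * Qfun b c g / (Real.pi * (g ^ 2 + τ ^ 2)) *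
          Real.exp (-‖y‖ ^ 2 / (g ^ 2 + τ ^ 2)) := by
  have hlog : 0 < Real.log 10 := Real.log_pos (by norm_num)
  have hb0 : b < 0 := by
    rw [hb]
    exact div_neg_of_neg_of_pos (by simp) (by positivity)
  have hγ0 : 0 ≤ γ := by rw [hγ]; positivity
  calc _ = a / Real.pi * ∫ w : ℂ, ∫ g in Ioi (0 : ℝ), g ^ (-γ - 2) * Qfun b c g *
        Real.exp (-‖y - w‖ ^ 2 / g ^ 2) * cgauss (τ ^ 2) w := by
        simp_rw [pH, integral_mul_const, mul_assoc (a / Real.pi), integral_const_mul]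
    _ = a / Real.pi * ∫ g in Ioi (0 : ℝ), ∫ w : ℂ, g ^ (-γ - 2) * Qfun b c g *
        Real.exp (-‖y - w‖ ^ 2 / g ^ 2) * cgauss (τ ^ 2) w := by
        rw [integral_integral_swap (integrable_prod_mixture_mul_cgauss c hb0 hγ0 hτ y)]
    _ = _ := by
        rw [← integral_const_mul]
        refine setIntegral_congr_fun measurableSet_Ioi fun g (hg : 0 < g) => ?_
        rw [integral_mixture_mul_cgauss b c γ hg hτ]
        field_simp
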